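/- If f : V → ℝ^d is a bi-Lipschitz mapping on a nonempty open set V ⊆ ℝ^d and F ∈ G^h(f(V)), then f^{-1}(F) ∈ G^h(V). -/

import Mathlib

open MeasureTheory Set Filter

/-- `h ∈ 𝔇_d`: gauge function. -/
def IsGauge (d : ℕ) (h : ℝ → ℝ) : Prop :=
  h 0 = 0 ∧ ∃ ε > 0, ContinuousOn h (Icc 0 ε) ∧ MonotoneOn h (Icc 0 ε) ∧
    (∀ r ∈ Ioc 0 ε, 0 < h r / r ^ d) ∧ AntitoneOn (fun r => h r / r ^ d) (Ioc 0 ε)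

/-- `g` is a gauge function with admissible scale `ε`. -/
def IsGaugeOn (d : ℕ) (ε : ℝ) (g : ℝ → ℝ) : Prop :=
  g 0 = 0 ∧ 0 < ε ∧ ContinuousOn g (Icc 0 ε) ∧ MonotoneOn g (Icc 0 ε) ∧
    (∀ r ∈ Ioc 0 ε, 0 < g r / r ^ d) ∧ AntitoneOn (fun r => g r / r ^ d) (Ioc 0 ε)

/-- `g ≺ h`: `g/h` monotonically tends to infinity at zero. -/
def GaugePrec (g h : ℝ → ℝ) : Prop :=
  Tendsto (fun r => g r / h r) (nhdsWithin 0 (Ioi 0)) atTop ∧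
    ∃ ε > 0, AntitoneOn (fun r => g r / h r) (Ioc 0 ε)

/-- The `c`-adic cube `c^{-j}(k + [0,1)^d)`. -/
def cadicCube (d c : ℕ) (j : ℤ) (k : Fin d → ℤ) : Set (Fin d → ℝ) :=
  {x | ∀ s, x s ∈ Ico ((k s : ℝ) * (c : ℝ) ^ (-j)) (((k s : ℝ) + 1) * (c : ℝ) ^ (-j))}

/-- The outer net measure `M^g_∞` built from `c`-adic cubes of diameter `< ε`. -/
noncomputable def netMeasure (d c : ℕ) (ε : ℝ) (g : ℝ → ℝ) (E : Set (Fin d → ℝ)) : ENNReal :=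
  ⨅ (lam : ℕ → Set (Fin d → ℝ))
    (_ : ∀ p, lam p = ∅ ∨ ∃ j k, lam p = cadicCube d c j k)
    (_ : ∀ p, (EMetric.diam (lam p)).toReal < ε)
    (_ : E ⊆ ⋃ p, lam p),
    ∑' p, ENNReal.ofReal (g (EMetric.diam (lam p)).toReal)

/-- `F ∈ G^h(V)`: `F` is a `G_δ`-set and `M^g_∞(F ∩ U) = M^g_∞(U)` for every gauge
function `g ≺ h` and every open `U ⊆ V`. -/
def LargeIntersection (d c : ℕ) (h : ℝ → ℝ) (V F : Set (Fin d → ℝ)) : Prop :=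
  IsGδ F ∧ ∀ g ε, IsGaugeOn d ε g → GaugePrec g h →
    ∀ U : Set (Fin d → ℝ), IsOpen U → U ⊆ V →
      netMeasure d c ε g (F ∩ U) = netMeasure d c ε g U

open scoped NNReal ENNReal Topology

/-- Lipschitz maps preserve null sets. -/
lemma null_image_of_lipschitz {d : ℕ} {L : ℝ≥0} {r : (Fin d → ℝ) → (Fin d → ℝ)}
    (hr : LipschitzWith L r) {s : Set (Fin d → ℝ)} (hs : volume s = 0) :
    volume (r '' s) = 0 := by
  have h := (hr.lipschitzOnWith (s := s)).hausdorffMeasure_image_le (d := (Fintype.card (Fin d) : ℝ))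
    (by positivity)
  rw [hausdorffMeasure_pi_real, hs, mul_zero] at h
  exact le_antisymm h bot_le

/-- `det (1 + A)` is an affine combination of `det (1 + t_i A)`. -/
lemma det_interp {d : ℕ} (v : ℕ → ℝ) (hv : Function.Injective v) :
    ∃ ℓ : ℕ → ℝ, ∑ i ∈ Finset.range (d + 1), ℓ i = 1 ∧
      ∀ A : (Fin d → ℝ) →L[ℝ] (Fin d → ℝ),
        (1 + A).det = ∑ i ∈ Finset.range (d + 1), ℓ i * (1 + v i • A).det := by
  refine ⟨fun i => (Lagrange.basis (Finset.range (d+1)) v i).eval 1, ?_, ?_⟩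
  · have := Lagrange.sum_basis (s := Finset.range (d+1)) (v := v) hv.injOn ⟨0, by simp⟩
    rw [← Polynomial.eval_finsetSum, this]; simp
  · intro A
    set M := LinearMap.toMatrix' (A : (Fin d → ℝ) →ₗ[ℝ] (Fin d → ℝ)) with hM
    set p : Polynomial ℝ :=
      Matrix.det ((Polynomial.X : Polynomial ℝ) • M.map Polynomial.C
        + (1 : Matrix (Fin d) (Fin d) ℝ).map Polynomial.C) with hp
    have hdeg : p.natDegree ≤ d := by
      have := Polynomial.natDegree_det_X_add_C_le M (1 : Matrix (Fin d) (Fin d) ℝ)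
      rwa [Fintype.card_fin] at this
    have heval : ∀ t : ℝ, p.eval t = (1 + t • A).det := by
      intro t
      have e1 : (1 + t • A).det = Matrix.det (1 + t • M) := by
        rw [ContinuousLinearMap.det, ← LinearMap.det_toMatrix']
        congr 1
        have : ((1 + t • A : (Fin d → ℝ) →L[ℝ] (Fin d → ℝ)) : (Fin d → ℝ) →ₗ[ℝ] (Fin d → ℝ))
          = LinearMap.id + t • (A : (Fin d → ℝ) →ₗ[ℝ] (Fin d → ℝ)) := rfl
        rw [this, map_add, map_smul, LinearMap.toMatrix'_id]
      rw [e1, hp, ← Polynomial.coe_evalRingHom, RingHom.map_det]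
      congr 1
      ext i j
      simp [Matrix.one_apply, add_comm]
      split_ifs <;> simp [mul_comm]
    have hlt : p.degree < (Finset.range (d+1)).card := by
      rw [Finset.card_range]
      exact lt_of_le_of_lt Polynomial.degree_le_natDegree (by exact_mod_cast Nat.lt_succ_of_le hdeg)
    have h := Lagrange.eq_interpolate (s := Finset.range (d+1)) (v := v) hv.injOn hlt
    have h1 := congrArg (Polynomial.eval 1) h
    rw [heval, one_smul] at h1
    rw [h1, Lagrange.interpolate_apply, Polynomial.eval_finsetSum]
    refine Finset.sum_congr rfl fun i _ => ?_
    rw [Polynomial.eval_mul, Polynomial.eval_C, heval]; ring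

/-- Small perturbations of the identity preserve the volume of the ball. -/
lemma small_perturb {d : ℕ} {L : ℝ≥0} {g : (Fin d → ℝ) → (Fin d → ℝ)}
    (hg : LipschitzWith L g) {R : ℝ} (h0 : ∀ x, R ≤ ‖x‖ → g x = 0)
    {t : ℝ} (ht : 0 ≤ t) (htL : t * L < 1)
    (hpos : ∀ x, 0 < (1 + t • fderiv ℝ g x).det) :
    IntegrableOn (fun x => (1 + t • fderiv ℝ g x).det) 
      (Metric.ball 0 R ∩ {x | DifferentiableAt ℝ g x}) ∧
    ∫ x in Metric.ball 0 R ∩ {x | DifferentiableAt ℝ g x}, (1 + t • fderiv ℝ g x).det 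
      = (volume (Metric.ball (0 : Fin d → ℝ) R)).toReal := by
  classical
  set φ : (Fin d → ℝ) → (Fin d → ℝ) := fun x => x + t • g x with hφ
  set D := Metric.ball (0 : Fin d → ℝ) R ∩ {x | DifferentiableAt ℝ g x} with hD
  have hDm : MeasurableSet D :=
    Metric.isOpen_ball.measurableSet.inter (measurableSet_of_differentiableAt ℝ g)
  have hinj : Function.Injective φ := by
    intro x y hxy
    have h1 : x - y = t • (g y - g x) := by
      have : x + t • g x = y + t • g y := hxy
      rw [smul_sub]; linear_combination (exp := 1) this
    have h2 : ‖x - y‖ ≤ t * L * ‖x - y‖ := by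
      calc ‖x - y‖ = t * ‖g y - g x‖ := by
            conv_lhs => rw [h1]
            rw [norm_smul, Real.norm_of_nonneg ht]
        _ ≤ t * (L * ‖y - x‖) := by
            gcongr; simpa [dist_eq_norm] using hg.dist_le_mul y x
        _ = _ := by rw [norm_sub_rev]; ring
    have h3 : ‖x - y‖ = 0 := by
      by_contra hne
      have : 0 < ‖x - y‖ := lt_of_le_of_ne (norm_nonneg _) (Ne.symm hne)
      nlinarith
    exact sub_eq_zero.1 (norm_eq_zero.1 h3)
  have hsurj : Function.Surjective φ := by
    rcases subsingleton_or_nontrivial (Fin d → ℝ) with hs | hs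
    · intro y; exact ⟨y, Subsingleton.elim _ _⟩
    have hA : ApproximatesLinearOn φ
        ((ContinuousLinearEquiv.refl ℝ (Fin d → ℝ)) : (Fin d → ℝ) →L[ℝ] (Fin d → ℝ)) univ
        (⟨t, ht⟩ * L) := by
      intro x _ y _
      have : φ x - φ y - ((ContinuousLinearEquiv.refl ℝ (Fin d → ℝ) :
          (Fin d → ℝ) →L[ℝ] (Fin d → ℝ)) (x - y)) = t • (g x - g y) := by
        simp [hφ, smul_sub]; abel
      rw [this, norm_smul, Real.norm_of_nonneg ht]
      have := hg.dist_le_mul x y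
      rw [dist_eq_norm, dist_eq_norm] at this
      calc t * ‖g x - g y‖ ≤ t * (L * ‖x - y‖) := by gcongr
        _ = _ := by change _ = t * L * _; ring
    apply hA.surjective
    right
    have : ‖(((ContinuousLinearEquiv.refl ℝ (Fin d → ℝ)).symm :
      (Fin d → ℝ) ≃L[ℝ] (Fin d → ℝ)) : (Fin d → ℝ) →L[ℝ] (Fin d → ℝ))‖₊ = 1 := by
      have : ‖ContinuousLinearMap.id ℝ (Fin d → ℝ)‖₊ = 1 := by
        ext; simp
      exact this
    rw [this, inv_one, ← NNReal.coe_lt_coe]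
    exact htL
  have hout : ∀ x, R ≤ ‖x‖ → φ x = x := fun x hx => by simp [hφ, h0 x hx]
  have himg : φ '' Metric.ball 0 R = Metric.ball 0 R := by
    apply Subset.antisymm
    · rintro _ ⟨x, hx, rfl⟩
      by_contra hn
      rw [mem_ball_zero_iff, not_lt] at hn
      have := hinj (hout _ hn)
      rw [this] at hn
      rw [mem_ball_zero_iff] at hx
      linarith
    · intro y hy
      obtain ⟨x, rfl⟩ := hsurj y
      refine ⟨x, ?_, rfl⟩
      by_contra hn
      rw [mem_ball_zero_iff, not_lt] at hn
      rw [hout x hn, mem_ball_zero_iff] at hy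
      linarith
  have hφL : LipschitzWith (1 + ⟨t, ht⟩ * L) φ := by
    apply LipschitzWith.id.add
    refine LipschitzWith.of_dist_le_mul fun x y => ?_
    have := hg.dist_le_mul x y
    rw [dist_smul₀, Real.norm_of_nonneg ht]
    calc t * dist (g x) (g y) ≤ t * (L * dist x y) := by gcongr
      _ = _ := by change _ = t * L * _; ring
  have hnull : volume (φ '' (Metric.ball 0 R \ D)) = 0 := by
    apply null_image_of_lipschitz hφL
    have := hg.ae_differentiableAt (μ := volume)
    refine measure_mono_null ?_ (ae_iff.1 this)
    intro x hx
    exact fun h => hx.2 ⟨hx.1, h⟩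
  have hvol : volume (φ '' D) = volume (Metric.ball (0 : Fin d → ℝ) R) := by
    apply le_antisymm
    · rw [← himg]; exact measure_mono (image_mono inter_subset_left)
    · have : Metric.ball (0 : Fin d → ℝ) R ⊆ φ '' D ∪ φ '' (Metric.ball 0 R \ D) := by
        rw [← image_union, union_sdiff_cancel inter_subset_left, himg]
      calc _ ≤ volume (φ '' D ∪ φ '' (Metric.ball 0 R \ D)) := measure_mono this
        _ ≤ _ := measure_union_le _ _
        _ = _ := by rw [hnull, add_zero]
  have hder : ∀ x ∈ D, HasFDerivWithinAt φ (1 + t • fderiv ℝ g x) D x := by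
    intro x hx
    have h1 : HasFDerivAt g (fderiv ℝ g x) x := DifferentiableAt.hasFDerivAt hx.2
    exact ((hasFDerivAt_id x).add (h1.const_smul t)).hasFDerivWithinAt
  have key := lintegral_abs_det_fderiv_eq_addHaar_image volume hDm hder hinj.injOn
  have hintg := (integrableOn_image_iff_integrableOn_abs_det_fderiv_smul volume hDm hder hinj.injOn
    (fun _ => (1 : ℝ))).1 (by
      rw [integrableOn_const_iff]
      right; rw [hvol]; exact measure_ball_lt_top)
  have heq := integral_image_eq_integral_abs_det_fderiv_smul volume hDm hder hinj.injOn
    (fun _ => (1 : ℝ))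
  simp only [smul_eq_mul, mul_one, abs_of_pos (hpos _)] at hintg heq
  refine ⟨hintg, ?_⟩
  rw [← heq]
  simp [Measure.real, hvol]

lemma exists_norm_eq_pi {d : ℕ} [Nonempty (Fin d)] (x : Fin d → ℝ) : ∃ i, ‖x i‖ = ‖x‖ := by
  obtain ⟨i, -, hi⟩ := Finset.exists_mem_eq_sup' (s := (Finset.univ : Finset (Fin d)))
    Finset.univ_nonempty (fun i => ‖x i‖)
  refine ⟨i, le_antisymm (norm_le_pi_norm x i) ?_⟩
  rw [pi_norm_le_iff_of_nonneg (norm_nonneg _)]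
  intro j
  rw [← hi]
  exact Finset.le_sup' (fun i => ‖x i‖) (Finset.mem_univ j)

/-- No Lipschitz retraction onto the sphere (sup norm). -/
lemma no_retraction {d : ℕ} {L : ℝ≥0} {r : (Fin d → ℝ) → (Fin d → ℝ)}
    (hr : LipschitzWith L r) {R : ℝ} (hR : 0 < R) (h0 : ∀ x, R ≤ ‖x‖ → r x = x)
    (h1 : ∀ x, ‖x‖ ≤ R → ‖r x‖ = R) : False := by
  set g : (Fin d → ℝ) → (Fin d → ℝ) := fun x => r x - x with hgdef
  have hg : LipschitzWith (L + 1) g := hr.sub LipschitzWith.id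
  have hg0 : ∀ x, R ≤ ‖x‖ → g x = 0 := fun x hx => by simp [hgdef, h0 x hx]
  -- small t
  have hdet : ∀ᶠ A in 𝓝 (1 : (Fin d → ℝ) →L[ℝ] (Fin d → ℝ)), 0 < A.det := by
    apply (ContinuousLinearMap.continuous_det.continuousAt).eventually
    apply lt_mem_nhds
    have : (1 : (Fin d → ℝ) →L[ℝ] (Fin d → ℝ)).det = 1 := by
      rw [ContinuousLinearMap.det]; exact LinearMap.det_id
    simp only [this]; exact one_pos
  obtain ⟨η, hη, hηd⟩ := Metric.eventually_nhds_iff.1 hdet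
  set t0 : ℝ := min (η / 2) (1 / 2) / (L + 1) with ht0
  have ht0pos : 0 < t0 := by positivity
  set v : ℕ → ℝ := fun i => t0 / (i + 1) with hv
  have hvinj : Function.Injective v := by
    intro i j hij
    simp only [hv] at hij
    rw [div_eq_div_iff (by positivity) (by positivity)] at hij
    have := mul_left_cancel₀ ht0pos.ne' hij
    exact_mod_cast (add_right_cancel this).symm
  have hvpos : ∀ i, 0 < v i := fun i => by simp only [hv]; positivity
  have hvle : ∀ i, v i ≤ t0 := fun i => by
    simp only [hv]; apply div_le_self ht0pos.le; linarith [(Nat.cast_nonneg i : (0:ℝ) ≤ i)]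
  have ht0L : t0 * (L + 1) = min (η / 2) (1 / 2) := by rw [ht0]; field_simp
  have hvL : ∀ i, v i * (L + 1) ≤ min (η / 2) (1 / 2) := fun i => by
    rw [← ht0L]; have := hvle i; gcongr
  obtain ⟨ℓ, hℓ, hintg⟩ := det_interp (d := d) v hvinj
  have hS : ∀ i, _ := fun i => small_perturb hg hg0 (hvpos i).le
    (by push_cast; have := (hvL i).trans (min_le_right _ _); linarith)
    (by
      intro x
      apply hηd
      rw [dist_eq_norm, add_sub_cancel_left, norm_smul, Real.norm_of_nonneg (hvpos i).le]
      have h3 : ‖fderiv ℝ g x‖ ≤ L + 1 := by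
        simpa using norm_fderiv_le_of_lipschitz ℝ hg (x₀ := x)
      have := (hvL i).trans (min_le_left _ _)
      have h4 : v i * ‖fderiv ℝ g x‖ ≤ v i * (L + 1) := by
        have := hvpos i; gcongr
      linarith)
  set D := Metric.ball (0 : Fin d → ℝ) R ∩ {x | DifferentiableAt ℝ g x} with hD
  have hDm : MeasurableSet D :=
    Metric.isOpen_ball.measurableSet.inter (measurableSet_of_differentiableAt ℝ g)
  have hzero : ∀ x ∈ D, (1 + fderiv ℝ g x).det = 0 := by
    intro x hx
    have hxR : ‖x‖ < R := mem_ball_zero_iff.1 hx.1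
    have hgd : HasFDerivAt g (fderiv ℝ g x) x := DifferentiableAt.hasFDerivAt hx.2
    have hrd : HasFDerivAt r (1 + fderiv ℝ g x) x := by
      have := (hasFDerivAt_id x).add hgd
      refine this.congr_of_eventuallyEq (Eventually.of_forall fun y => ?_)
      simp [hgdef]
    have hnear : ∀ᶠ y in 𝓝 x, ‖r y‖ = R := by
      filter_upwards [Metric.isOpen_ball.mem_nhds hx.1] with y hy
      exact h1 y (mem_ball_zero_iff.1 hy).le
    have hrx : ‖r x‖ = R := h1 x hxR.le
    have hne : Nonempty (Fin d) := by
      by_contra hem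
      rw [not_nonempty_iff] at hem
      have : r x = 0 := Subsingleton.elim _ _
      rw [this, norm_zero] at hrx; linarith
    obtain ⟨i, hi⟩ := exists_norm_eq_pi (r x)
    have hri : HasFDerivAt (fun y => r y i)
        ((ContinuousLinearMap.proj i).comp (1 + fderiv ℝ g x)) x :=
      (hasFDerivAt_pi'.1 hrd) i
    have hz : (ContinuousLinearMap.proj (R := ℝ) (φ := fun _ : Fin d => ℝ) i).comp
        (1 + fderiv ℝ g x) = 0 := by
      have hle : ∀ᶠ y in 𝓝 x, |r y i| ≤ R := by
        filter_upwards [hnear] with y hy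
        rw [← hy]; exact norm_le_pi_norm (r y) i
      have hi' : |r x i| = R := by rw [← hrx, ← hi]; rfl
      rcases abs_choice (r x i) with hc | hc
      · have : IsLocalMax (fun y => r y i) x := by
          filter_upwards [hle] with y hy
          rw [← hc, hi']; exact (le_abs_self _).trans hy
        exact this.hasFDerivAt_eq_zero hri
      · have : IsLocalMin (fun y => r y i) x := by
          filter_upwards [hle] with y hy
          have : r x i = -R := by linarith
          rw [this]; exact neg_le_of_abs_le hy
        exact this.hasFDerivAt_eq_zero hri
    by_contra hdne
    have hu : IsUnit (LinearMap.det ((1 + fderiv ℝ g x : (Fin d → ℝ) →L[ℝ] (Fin d → ℝ)) :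
      (Fin d → ℝ) →ₗ[ℝ] (Fin d → ℝ))) := isUnit_iff_ne_zero.2 hdne
    have hsurj := (LinearMap.equivOfIsUnitDet hu).surjective (Pi.single i 1)
    obtain ⟨w, hw⟩ := hsurj
    have h5 : (1 + fderiv ℝ g x) w = Pi.single i 1 := by
      rw [← hw, LinearMap.equivOfIsUnitDet_apply]; rfl
    have h6 := DFunLike.congr_fun hz w
    simp only [ContinuousLinearMap.comp_apply] at h6
    rw [h5] at h6
    simp at h6
  have e1 : ∫ x in D, (1 + fderiv ℝ g x).det = 0 := by
    rw [setIntegral_congr_fun hDm (g := fun _ => (0:ℝ)) hzero]; simp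
  have e2 : ∫ x in D, (1 + fderiv ℝ g x).det
      = (volume (Metric.ball (0 : Fin d → ℝ) R)).toReal := by
    rw [integral_congr_ae (Eventually.of_forall fun x => hintg (fderiv ℝ g x))]
    rw [integral_finsetSum _ (fun i _ => (hS i).1.const_mul _)]
    simp_rw [integral_const_mul]
    rw [Finset.sum_congr rfl (fun i _ => by rw [(hS i).2]), ← Finset.sum_mul, hℓ, one_mul]
  rw [e1] at e2
  have : 0 < (volume (Metric.ball (0 : Fin d → ℝ) R)).toReal :=
    ENNReal.toReal_pos (Metric.measure_ball_pos _ _ hR).ne' measure_ball_lt_top.ne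
  linarith

/-- Pushing the ball of radius `ε` (minus a small ball) onto its sphere. -/
lemma exists_push {d : ℕ} {δ ε : ℝ} (hδ : 0 < δ) (hδε : δ ≤ ε) :
    ∃ (L : ℝ≥0) (P : (Fin d → ℝ) → (Fin d → ℝ)), LipschitzWith L P ∧
      (∀ z, ε ≤ ‖z‖ → P z = z) ∧ (∀ z, δ ≤ ‖z‖ → ‖z‖ ≤ ε → ‖P z‖ = ε) := by
  have hε : 0 < ε := hδ.trans_le hδε
  set Q : (Fin d → ℝ) → (Fin d → ℝ) := fun z => (max 1 (ε / ‖z‖)) • z with hQ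
  have hL : LipschitzOnWith (⟨ε / δ, by positivity⟩ + ⟨ε / δ, by positivity⟩) Q
      {z | δ ≤ ‖z‖} := by
    refine LipschitzOnWith.of_dist_le_mul fun z hz w hw => ?_
    have hz' : δ ≤ ‖z‖ := hz
    have hw' : δ ≤ ‖w‖ := hw
    have hz0 : 0 < ‖z‖ := hδ.trans_le hz'
    have hw0 : 0 < ‖w‖ := hδ.trans_le hw'
    rw [dist_eq_norm, dist_eq_norm]
    have e : Q z - Q w = (max 1 (ε / ‖z‖)) • (z - w)
        + (max 1 (ε / ‖z‖) - max 1 (ε / ‖w‖)) • w := by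
      simp only [hQ, smul_sub, sub_smul]; abel
    have h1 : ‖(max 1 (ε / ‖z‖)) • (z - w)‖ ≤ ε / δ * ‖z - w‖ := by
      rw [norm_smul, Real.norm_of_nonneg (by positivity)]
      gcongr
      apply max_le
      · rw [le_div_iff₀ hδ]; linarith
      · gcongr
    have h2 : ‖(max 1 (ε / ‖z‖) - max 1 (ε / ‖w‖)) • w‖ ≤ ε / δ * ‖z - w‖ := by
      rw [norm_smul, Real.norm_eq_abs]
      have h3 : |max 1 (ε / ‖z‖) - max 1 (ε / ‖w‖)| ≤ |ε / ‖z‖ - ε / ‖w‖| := by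
        have := abs_max_sub_max_le_max 1 (ε / ‖z‖) 1 (ε / ‖w‖)
        simpa using this
      have h4 : ε / ‖z‖ - ε / ‖w‖ = ε * (‖w‖ - ‖z‖) / (‖z‖ * ‖w‖) := by
        field_simp
      have h5 : |‖w‖ - ‖z‖| ≤ ‖z - w‖ := by
        rw [norm_sub_rev]; exact abs_norm_sub_norm_le w z
      calc _ ≤ |ε / ‖z‖ - ε / ‖w‖| * ‖w‖ := by gcongr
        _ = ε * |‖w‖ - ‖z‖| / ‖z‖ := by
            rw [h4, abs_div, abs_mul, abs_of_pos hε, abs_of_pos (mul_pos hz0 hw0)]; field_simp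
        _ ≤ ε * ‖z - w‖ / δ := by gcongr
        _ = _ := by ring
    rw [e]
    calc _ ≤ _ := norm_add_le _ _
      _ ≤ ε / δ * ‖z - w‖ + ε / δ * ‖z - w‖ := add_le_add h1 h2
      _ = _ := by change _ = (ε / δ + ε / δ) * _; ring
  obtain ⟨P, hP, hPQ⟩ := hL.extend_pi
  refine ⟨_, P, hP, fun z hz => ?_, fun z hz hz2 => ?_⟩
  · rw [← hPQ (show z ∈ {z | δ ≤ ‖z‖} from hδε.trans hz)]
    simp only [hQ]
    rw [max_eq_left, one_smul]
    rw [div_le_one (hε.trans_le hz)]; exact hz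
  · rw [← hPQ (show z ∈ {z | δ ≤ ‖z‖} from hz)]
    have hz0 : 0 < ‖z‖ := hδ.trans_le hz
    simp only [hQ]
    rw [max_eq_right, norm_smul, Real.norm_of_nonneg (by positivity)]
    · field_simp
    · rw [le_div_iff₀ hz0]; linarith

/-- A compactly supported Lipschitz perturbation of the identity has a zero. -/
lemma exists_zero {d : ℕ} {L : ℝ≥0} {ψ : (Fin d → ℝ) → (Fin d → ℝ)}
    (hψ : LipschitzWith L ψ) {R : ℝ} (hR : 0 < R) (h0 : ∀ x, R ≤ ‖x‖ → ψ x = 0) :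
    ∃ x, x + ψ x = 0 := by
  by_contra! hne
  set φ : (Fin d → ℝ) → (Fin d → ℝ) := fun x => x + ψ x with hφ
  have hφL : LipschitzWith (1 + L) φ := LipschitzWith.id.add hψ
  have hcomp : IsCompact (Metric.closedBall (0 : Fin d → ℝ) R) := isCompact_closedBall _ _
  have hnonempty : (Metric.closedBall (0 : Fin d → ℝ) R).Nonempty :=
    ⟨0, Metric.mem_closedBall_self hR.le⟩
  obtain ⟨x1, -, h1⟩ := hcomp.exists_isMinOn hnonempty (hφL.continuous.norm.continuousOn)
  obtain ⟨x2, -, h2⟩ := hcomp.exists_isMaxOn hnonempty (hφL.continuous.norm.continuousOn)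
  have hδ1 : 0 < ‖φ x1‖ := norm_pos_iff.2 (hne x1)
  set R' := max R ‖φ x2‖ with hR'
  have hRR' : R ≤ R' := le_max_left _ _
  set δ := min ‖φ x1‖ R with hδdef
  have hδ : 0 < δ := lt_min hδ1 hR
  have hδR : δ ≤ R' := (min_le_right _ _).trans hRR'
  obtain ⟨L', P, hP, hP1, hP2⟩ := exists_push (d := d) hδ hδR
  have hφout : ∀ x, R ≤ ‖x‖ → φ x = x := fun x hx => by simp [hφ, h0 x hx]
  have hlow : ∀ x, δ ≤ ‖φ x‖ := by
    intro x
    rcases le_total ‖x‖ R with hx | hx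
    · exact (min_le_left _ _).trans (h1 (mem_closedBall_zero_iff.2 hx))
    · rw [hφout x hx]; exact (min_le_right _ _).trans hx
  refine no_retraction (hP.comp hφL) (hR.trans_le hRR') (fun x hx => ?_) (fun x hx => ?_)
  · simp only [Function.comp]
    rw [hφout x (hRR'.trans hx)]; exact hP1 x hx
  · apply hP2 _ (hlow x)
    rcases le_total ‖x‖ R with hx' | hx'
    · exact le_trans (h2 (mem_closedBall_zero_iff.2 hx')) (le_max_right _ _)
    · rw [hφout x hx']; exact hx

/-- A Lipschitz map of a ball, close to the identity, takes the value of the center. -/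
lemma exists_center {d : ℕ} {L : ℝ≥0} {θ : (Fin d → ℝ) → (Fin d → ℝ)}
    (hθ : LipschitzWith L θ) {R : ℝ} (hR : 0 < R) (x0 : Fin d → ℝ)
    (h0 : ∀ x ∈ Metric.closedBall x0 R, ‖θ x - x‖ ≤ R / 4) :
    ∃ x ∈ Metric.closedBall x0 R, θ x = x0 := by
  set τ : (Fin d → ℝ) → ℝ := fun x => max 0 (R - ‖x‖) with hτ
  have hτL : LipschitzWith 1 τ := by
    refine LipschitzWith.const_max ?_ 0
    have := (LipschitzWith.const (α := Fin d → ℝ) R).sub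
      (lipschitzWith_one_norm (E := Fin d → ℝ))
    simpa using this
  have hτ0 : ∀ x, 0 ≤ τ x := fun x => le_max_left _ _
  set η : (Fin d → ℝ) → (Fin d → ℝ) := fun x => θ (x + x0) - (x + x0) with hη
  have hηL : LipschitzWith (L + 1) η := by
    have ht : LipschitzWith 1 (fun x : Fin d → ℝ => x + x0) := by
      refine LipschitzWith.of_dist_le_mul fun x y => ?_
      simp
    have := (hθ.comp ht).sub ht
    simpa using this
  set ψ : (Fin d → ℝ) → (Fin d → ℝ) := fun x i => max (-τ x) (min (η x i) (τ x)) with hψ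
  have hψL : LipschitzWith (max 1 (max (L + 1) 1)) ψ := by
    refine LipschitzWith.of_dist_le_mul fun x y => ?_
    rw [dist_pi_le_iff (by positivity)]
    intro i
    have hi : LipschitzWith (L + 1) (fun x => η x i) := by
      refine LipschitzWith.of_dist_le_mul fun x y => ?_
      exact (dist_le_pi_dist _ _ i).trans (hηL.dist_le_mul x y)
    exact (hτL.neg.max (hi.min hτL)).dist_le_mul x y
  have hψle : ∀ x i, |ψ x i| ≤ |η x i| := by
    intro x i
    simp only [hψ]
    have := hτ0 x
    rw [abs_le]
    refine ⟨?_, ?_⟩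
    · have h1 := neg_abs_le (η x i)
      rcases le_total (η x i) (τ x) with h | h
      · rw [min_eq_left h]; exact h1.trans (le_max_right _ _)
      · rw [min_eq_right h]; exact (by linarith [abs_nonneg (η x i)] : _ ≤ τ x).trans (le_max_right _ _)
    · apply max_le
      · linarith [abs_nonneg (η x i)]
      · exact (min_le_left _ _).trans (le_abs_self _)
  obtain ⟨x, hx⟩ := exists_zero hψL hR (fun x hx => by
    ext i
    have : τ x = 0 := by simp only [hτ]; exact max_eq_left (by linarith)
    simp only [hψ, this, Pi.zero_apply, neg_zero]
    exact max_eq_left (min_le_right _ _))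
  have hxeq : x = - ψ x := eq_neg_of_add_eq_zero_left hx
  have hxR : ‖x‖ ≤ R := by
    by_contra! hlt
    have : ψ x = 0 := by
      ext i
      have : τ x = 0 := by simp only [hτ]; exact max_eq_left (by linarith)
      simp only [hψ, this, Pi.zero_apply, neg_zero]
      exact max_eq_left (min_le_right _ _)
    rw [this, neg_zero] at hxeq
    rw [hxeq, norm_zero] at hlt; linarith
  have hmem : x + x0 ∈ Metric.closedBall x0 R := by
    simpa [dist_eq_norm] using hxR
  have hη4 : ‖η x‖ ≤ R / 4 := h0 _ hmem
  have hx4 : ‖x‖ ≤ R / 4 := by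
    rw [pi_norm_le_iff_of_nonneg (by positivity)]
    intro i
    have : x i = - ψ x i := congrFun hxeq i
    rw [this, norm_neg, Real.norm_eq_abs]
    exact (hψle x i).trans ((norm_le_pi_norm (η x) i).trans hη4)
  have hτx : R / 4 ≤ τ x := by
    simp only [hτ]; exact le_trans (by linarith) (le_max_right _ _)
  have hψη : ψ x = η x := by
    ext i
    have hi : |η x i| ≤ τ x := ((norm_le_pi_norm (η x) i).trans hη4).trans hτx
    rw [abs_le] at hi
    simp only [hψ]
    rw [min_eq_left hi.2, max_eq_right hi.1]
  refine ⟨x + x0, hmem, ?_⟩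
  rw [hψη] at hx
  simp only [hη] at hx
  have : θ (x + x0) - x0 = 0 := by rw [← hx]; abel
  exact sub_eq_zero.1 this

/-- Invariance of domain for bi-Lipschitz maps. -/
lemma image_mem_nhds_of_bilip {d : ℕ} (hd : 0 < d) {f : (Fin d → ℝ) → (Fin d → ℝ)} {K : ℝ}
    (hK : 0 < K) {x0 : Fin d → ℝ} {R : ℝ} (hR : 0 < R)
    (hbil : ∀ x ∈ Metric.closedBall x0 R, ∀ y ∈ Metric.closedBall x0 R,
      K⁻¹ * dist x y ≤ dist (f x) (f y) ∧ dist (f x) (f y) ≤ K * dist x y) :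
    f '' Metric.closedBall x0 R ∈ 𝓝 (f x0) := by
  have hne : Nonempty (Fin d) := ⟨⟨0, hd⟩⟩
  set B := Metric.closedBall x0 R with hB
  have hx0 : x0 ∈ B := Metric.mem_closedBall_self hR.le
  have hinv : ∀ x ∈ B, ∀ y ∈ B, dist x y ≤ K * dist (f x) (f y) := by
    intro x hx y hy
    have := (hbil x hx y hy).1
    rwa [inv_mul_le_iff₀ hK] at this
  have hinj : InjOn f B := by
    intro x hx y hy hxy
    have := hinv x hx y hy
    rw [hxy, dist_self, mul_zero] at this
    exact dist_le_zero.1 this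
  have hfL : LipschitzOnWith ⟨K, hK.le⟩ f B :=
    LipschitzOnWith.of_dist_le_mul fun x hx y hy => (hbil x hx y hy).2
  obtain ⟨f', hf'L, hff'⟩ := hfL.extend_pi
  have hGL0 : LipschitzOnWith ⟨K, hK.le⟩ (Function.invFunOn f B) (f '' B) := by
    refine LipschitzOnWith.of_dist_le_mul ?_
    rintro _ ⟨x, hx, rfl⟩ _ ⟨y, hy, rfl⟩
    rw [hinj.leftInvOn_invFunOn hx, hinj.leftInvOn_invFunOn hy]
    exact hinv x hx y hy
  obtain ⟨G, hGL, hGG⟩ := hGL0.extend_pi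
  have hGf : ∀ x ∈ B, G (f x) = x := fun x hx => by
    rw [← hGG (mem_image_of_mem f hx), hinj.leftInvOn_invFunOn hx]
  by_contra hnot
  -- choose ε
  obtain ⟨ε, hε, hεR⟩ : ∃ ε : ℝ, 0 < ε ∧ K * (2 * ε) + ε / (2 * K) ≤ R / 4 := by
    refine ⟨R / 4 / (K * 2 + 1 / (2 * K)), by positivity, ?_⟩
    apply le_of_eq
    field_simp
  obtain ⟨c, hc1, hc2⟩ : ∃ c, dist c (f x0) < ε / 2 ∧ c ∉ f '' B := by
    by_contra! hcon
    exact hnot (Metric.mem_nhds_iff.2 ⟨ε / 2, by positivity, fun y hy => hcon y hy⟩)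
  have hclosed : IsClosed (f '' B) :=
    ((isCompact_closedBall x0 R).image_of_continuousOn hfL.continuousOn).isClosed
  obtain ⟨δ0, hδ0, hδball⟩ := Metric.isOpen_iff.1 hclosed.isOpen_compl c hc2
  set δ := min δ0 ε
  have hδ : 0 < δ := lt_min hδ0 hε
  obtain ⟨L', P, hP, hP1, hP2⟩ := exists_push (d := d) hδ (min_le_right δ0 ε)
  have hnullS : volume (G '' Metric.sphere c ε) = 0 := by
    apply null_image_of_lipschitz hGL
    exact Measure.addHaar_sphere volume c ε
  obtain ⟨v, hv1, hv2⟩ : ∃ v ∈ Metric.ball x0 (ε / (2 * K)), v ∉ G '' Metric.sphere c ε := by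
    by_contra! hcon
    have h1 : volume (Metric.ball x0 (ε / (2 * K))) = 0 := measure_mono_null hcon hnullS
    exact (Metric.measure_ball_pos volume x0 (by positivity)).ne' h1
  set w : (Fin d → ℝ) → (Fin d → ℝ) := fun y => c + P (y - c) with hw
  have hwL : LipschitzWith L' w := by
    refine LipschitzWith.of_dist_le_mul fun x y => ?_
    simp only [hw, dist_add_left]
    have := hP.dist_le_mul (x - c) (y - c)
    rwa [dist_sub_right] at this
  set θ : (Fin d → ℝ) → (Fin d → ℝ) := fun x => G (w (f' x)) - (v - x0) with hθ
  have hθL : LipschitzWith (⟨K, hK.le⟩ * (L' * ⟨K, hK.le⟩)) θ := by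
    have := hGL.comp (hwL.comp hf'L)
    refine LipschitzWith.of_dist_le_mul fun x y => ?_
    simp only [hθ, dist_sub_right]
    exact this.dist_le_mul x y
  have hfar : ∀ x ∈ B, δ ≤ ‖f x - c‖ := by
    intro x hx
    by_contra! hlt
    refine hδball (a := f x) ?_ (mem_image_of_mem f hx)
    rw [Metric.mem_ball, dist_eq_norm]
    exact hlt.trans_le (min_le_left _ _)
  rw [Metric.mem_ball, dist_eq_norm] at hv1
  obtain ⟨x, hx, hxz⟩ := exists_center hθL hR x0 (by
    intro x hx
    have hx' : x ∈ B := hx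
    simp only [hθ]
    rw [← hff' hx']
    have hwy : ‖w (f x) - f x‖ ≤ 2 * ε := by
      rcases le_total ε ‖f x - c‖ with h | h
      · have : w (f x) = f x := by simp [hw, hP1 _ h]
        rw [this, sub_self, norm_zero]; positivity
      · have e : w (f x) - f x = P (f x - c) - (f x - c) := by simp only [hw]; abel
        rw [e]
        refine (norm_sub_le _ _).trans ?_
        rw [hP2 _ (hfar x hx') h]; linarith
    have h2 : ‖G (w (f x)) - x‖ ≤ K * (2 * ε) := by
      have h3 := hGL.dist_le_mul (w (f x)) (f x)
      rw [hGf x hx', dist_eq_norm, dist_eq_norm] at h3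
      exact h3.trans (mul_le_mul_of_nonneg_left hwy hK.le)
    have e : G (w (f x)) - (v - x0) - x = (G (w (f x)) - x) - (v - x0) := by abel
    rw [e]
    exact (norm_sub_le _ _).trans (by linarith))
  have hx' : x ∈ B := hx
  simp only [hθ] at hxz
  rw [← hff' hx'] at hxz
  have hGv : G (w (f x)) = v := by
    have : G (w (f x)) - v = 0 := by
      have h3 := sub_eq_zero.2 hxz
      rw [← h3]; abel
    exact sub_eq_zero.1 this
  rcases le_total ε ‖f x - c‖ with h | h
  · have e : w (f x) = f x := by simp [hw, hP1 _ h]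
    rw [e, hGf x hx'] at hGv
    have h4 : ε / 2 ≤ dist (f x) (f x0) := by
      have := dist_triangle (f x) (f x0) c
      rw [dist_comm (f x0) c, dist_eq_norm (f x) c] at this
      linarith
    have h5 := (hbil x hx' x0 hx0).2
    rw [hGv, dist_eq_norm v x0, ← hGv] at h5
    rw [hGv] at h5 h4
    have h6 : K * ‖v - x0‖ < K * (ε / (2 * K)) := by gcongr
    have h7 : K * (ε / (2 * K)) = ε / 2 := by field_simp
    linarith
  · refine hv2 ⟨w (f x), ?_, hGv⟩
    rw [Metric.mem_sphere, dist_eq_norm]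
    simp only [hw, add_sub_cancel_left]
    exact hP2 _ (hfar x hx') h

/-- Quantitative openness of bi-Lipschitz maps. -/
lemma ball_subset_image_of_bilip {d : ℕ} (hd : 0 < d) {f : (Fin d → ℝ) → (Fin d → ℝ)} {K : ℝ}
    (hK : 0 < K) {x0 : Fin d → ℝ} {R : ℝ} (hR : 0 < R)
    (hbil : ∀ x ∈ Metric.ball x0 R, ∀ y ∈ Metric.ball x0 R,
      K⁻¹ * dist x y ≤ dist (f x) (f y) ∧ dist (f x) (f y) ≤ K * dist x y) :
    Metric.ball (f x0) (R / K) ⊆ f '' Metric.ball x0 R := by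
  have hx0 : x0 ∈ Metric.ball x0 R := Metric.mem_ball_self hR
  have hopen : IsOpen (f '' Metric.ball x0 R) := by
    rw [isOpen_iff_mem_nhds]
    rintro _ ⟨x, hx, rfl⟩
    obtain ⟨r, hr, hrb⟩ := Metric.nhds_basis_closedBall.mem_iff.1
      (Metric.isOpen_ball.mem_nhds hx)
    have := image_mem_nhds_of_bilip hd hK hr
      (fun y hy z hz => hbil y (hrb hy) z (hrb hz))
    exact mem_of_superset this (image_mono hrb)
  have hcont : ContinuousOn f (Metric.ball x0 R) := by
    have : LipschitzOnWith ⟨K, hK.le⟩ f (Metric.ball x0 R) :=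
      LipschitzOnWith.of_dist_le_mul fun x hx y hy => (hbil x hx y hy).2
    exact this.continuousOn
  have hpre : IsPreconnected (Metric.ball (f x0) (R / K)) :=
    (convex_ball _ _).isPreconnected
  refine hpre.subset_of_closure_inter_subset hopen
    ⟨f x0, Metric.mem_ball_self (by positivity), mem_image_of_mem f hx0⟩ ?_
  rintro y ⟨hycl, hyb⟩
  rw [Metric.mem_ball] at hyb
  obtain ⟨ρ, hρ1, hρ2⟩ := exists_between hyb
  have hρK : K * ρ < R := by rwa [lt_div_iff₀ hK, mul_comm] at hρ2
  have hsub : Metric.closedBall x0 (K * ρ) ⊆ Metric.ball x0 R :=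
    Metric.closedBall_subset_ball hρK
  have hcl : IsClosed (f '' Metric.closedBall x0 (K * ρ)) :=
    ((isCompact_closedBall x0 (K * ρ)).image_of_continuousOn (hcont.mono hsub)).isClosed
  have : y ∈ closure (f '' Metric.closedBall x0 (K * ρ)) := by
    rw [Metric.mem_closure_iff] at hycl ⊢
    intro e he
    obtain ⟨_, ⟨z, hz, rfl⟩, hyz⟩ := hycl (min e (ρ - dist y (f x0))) (lt_min he (by linarith))
    refine ⟨f z, ⟨z, ?_, rfl⟩, hyz.trans_le (min_le_left _ _)⟩
    have h1 := (hbil z hz x0 hx0).1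
    rw [inv_mul_le_iff₀ hK] at h1
    rw [Metric.mem_closedBall]
    refine h1.trans ?_
    gcongr
    have h2 := hyz.trans_le (min_le_right _ _)
    have h3 := dist_triangle (f z) y (f x0)
    rw [dist_comm (f z) y] at h3
    linarith
  rw [hcl.closure_eq] at this
  exact image_mono hsub this

set_option linter.deprecated false

lemma mem_cube_iff {d c : ℕ} (hc : 2 ≤ c) {j : ℤ} {k : Fin d → ℤ} {x : Fin d → ℝ} :
    x ∈ cadicCube d c j k ↔ ∀ s, ⌊x s * (c : ℝ) ^ j⌋ = k s := by
  have hc0 : (0 : ℝ) < c := by positivity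
  have hp : (0 : ℝ) < (c : ℝ) ^ j := by positivity
  simp only [cadicCube, mem_setOf_eq, mem_Ico]
  refine forall_congr' fun s => ?_
  rw [Int.floor_eq_iff, zpow_neg, ← div_eq_mul_inv, ← div_eq_mul_inv, div_le_iff₀ hp, lt_div_iff₀ hp]

lemma self_mem_cube {d c : ℕ} (hc : 2 ≤ c) (j : ℤ) (x : Fin d → ℝ) :
    x ∈ cadicCube d c j (fun s => ⌊x s * (c : ℝ) ^ j⌋) := (mem_cube_iff hc).2 fun _ => rfl

lemma cube_subset {d c : ℕ} (hc : 2 ≤ c) {j j' : ℤ} (hj : j ≤ j') {k k' : Fin d → ℤ}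
    {x : Fin d → ℝ} (hx : x ∈ cadicCube d c j k) (hx' : x ∈ cadicCube d c j' k') :
    cadicCube d c j' k' ⊆ cadicCube d c j k := by
  have hc0 : (0 : ℝ) < c := by positivity
  obtain ⟨m, rfl⟩ := Int.le.dest hj
  have key : ∀ y : ℝ, ⌊y * (c : ℝ) ^ j⌋ = ⌊y * (c : ℝ) ^ (j + m)⌋ / ((c ^ m : ℕ) : ℤ) := by
    intro y
    rw [← Int.floor_div_natCast]
    congr 1
    rw [zpow_add₀ hc0.ne']
    push_cast
    rw [zpow_natCast]
    field_simp
  intro y hy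
  rw [mem_cube_iff hc] at *
  intro s
  rw [key, hy s, ← hx' s, ← key, hx s]

lemma cube_eq_pi {d c : ℕ} (j : ℤ) (k : Fin d → ℤ) :
    cadicCube d c j k = Set.pi univ (fun s => Ico ((k s : ℝ) * (c : ℝ) ^ (-j))
      (((k s : ℝ) + 1) * (c : ℝ) ^ (-j))) := by
  ext x; simp [cadicCube, Set.mem_pi]

lemma cube_nonempty {d c : ℕ} (hc : 2 ≤ c) (j : ℤ) (k : Fin d → ℤ) :
    (cadicCube d c j k).Nonempty := by
  have hc0 : (0 : ℝ) < c := by positivity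
  have hp : (0 : ℝ) < (c : ℝ) ^ (-j) := by positivity
  refine ⟨fun s => (k s : ℝ) * (c : ℝ) ^ (-j), fun s => ⟨le_rfl, ?_⟩⟩
  nlinarith

lemma ediam_cube {d c : ℕ} (hd : 0 < d) (hc : 2 ≤ c) (j : ℤ) (k : Fin d → ℤ) :
    Metric.ediam (cadicCube d c j k) = ENNReal.ofReal ((c : ℝ) ^ (-j)) := by
  apply le_antisymm
  · rw [cube_eq_pi]
    apply Metric.ediam_pi_le_of_le
    intro s
    rw [Real.ediam_Ico]
    apply le_of_eq; congr 1; ring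
  · have hne := cube_nonempty hc j k
    have h1 := (LipschitzWith.eval (α := fun _ : Fin d => ℝ) ⟨0, hd⟩).ediam_image_le
      (cadicCube d c j k)
    rw [cube_eq_pi] at h1 hne
    have h2 : Function.eval (⟨0, hd⟩ : Fin d) '' (Set.pi univ (fun s => Ico ((k s : ℝ) * (c : ℝ) ^ (-j))
      (((k s : ℝ) + 1) * (c : ℝ) ^ (-j)))) = _ := Set.eval_image_univ_pi hne
    rw [cube_eq_pi]
    have h3 : (fun x : Fin d → ℝ => x ⟨0, hd⟩) = Function.eval (⟨0, hd⟩ : Fin d) := rfl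
    rw [h2, Real.ediam_Ico, ENNReal.coe_one, one_mul] at h1
    refine le_trans (le_of_eq ?_) h1
    congr 1; ring

lemma diam_cube {d c : ℕ} (hd : 0 < d) (hc : 2 ≤ c) (j : ℤ) (k : Fin d → ℤ) :
    (EMetric.diam (cadicCube d c j k)).toReal = (c : ℝ) ^ (-j) := by
  have : EMetric.diam (cadicCube d c j k) = _ := ediam_cube hd hc j k
  rw [this, ENNReal.toReal_ofReal (by positivity)]

lemma diam_empty_toReal {d : ℕ} : (EMetric.diam (∅ : Set (Fin d → ℝ))).toReal = 0 := by
  have : EMetric.diam (∅ : Set (Fin d → ℝ)) = 0 := Metric.ediam_empty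
  rw [this]; rfl

lemma volume_cube {d c : ℕ} (j : ℤ) (k : Fin d → ℤ) :
    volume (cadicCube d c j k) = ENNReal.ofReal ((c : ℝ) ^ (-j)) ^ d := by
  rw [cube_eq_pi, Real.volume_pi_Ico]
  simp [add_mul]

/-- Net measures can be bounded using covers with a countable index type. -/
lemma net_le {d c : ℕ} {ε : ℝ} {g : ℝ → ℝ} (hε : 0 < ε) (hg0 : g 0 = 0) {ι : Type*} [Countable ι]
    {E : Set (Fin d → ℝ)} (lam : ι → Set (Fin d → ℝ))
    (h1 : ∀ p, lam p = ∅ ∨ ∃ j k, lam p = cadicCube d c j k)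
    (h2 : ∀ p, (EMetric.diam (lam p)).toReal < ε) (h3 : E ⊆ ⋃ p, lam p) :
    netMeasure d c ε g E ≤ ∑' p, ENNReal.ofReal (g (EMetric.diam (lam p)).toReal) := by
  classical
  haveI := Encodable.ofCountable ι
  have hcase : ∀ n, (⋃ b ∈ Encodable.decode₂ ι n, lam b) = ∅ ∨
      ∃ b, (⋃ b ∈ Encodable.decode₂ ι n, lam b) = lam b := by
    intro n
    cases hn : Encodable.decode₂ ι n with
    | none => left; simp
    | some b => right; exact ⟨b, by simp⟩
  rw [← tsum_iUnion_decode₂ (fun s => ENNReal.ofReal (g (EMetric.diam s).toReal))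
    (by simp only [diam_empty_toReal, hg0, ENNReal.ofReal_zero]) lam]
  unfold netMeasure
  refine iInf_le_of_le (fun n => ⋃ b ∈ Encodable.decode₂ ι n, lam b) ?_
  refine iInf_le_of_le ?_ ?_
  · intro n
    rcases hcase n with h | ⟨b, h⟩
    · exact Or.inl h
    · simp only [h]; exact h1 b
  refine iInf_le_of_le ?_ ?_
  · intro n
    rcases hcase n with h | ⟨b, h⟩
    · simp only [h, diam_empty_toReal]; exact hε
    · simp only [h]; exact h2 b
  refine iInf_le_of_le ?_ le_rfl
  rw [Encodable.iUnion_decode₂]; exact h3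

lemma net_mono {d c : ℕ} {ε : ℝ} {g : ℝ → ℝ} {E E' : Set (Fin d → ℝ)} (h : E ⊆ E') :
    netMeasure d c ε g E ≤ netMeasure d c ε g E' := by
  unfold netMeasure
  refine le_iInf fun lam => le_iInf fun h1 => le_iInf fun h2 => le_iInf fun h3 => ?_
  exact iInf_le_of_le lam (iInf_le_of_le h1 (iInf_le_of_le h2 (iInf_le_of_le (h.trans h3) le_rfl)))

/-- The gauge ratio inequality. -/
lemma gauge_ratio {d : ℕ} {ε : ℝ} {g : ℝ → ℝ} (hg : IsGaugeOn d ε g) {r R : ℝ} (hr : 0 < r)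
    (hrR : r ≤ R) (hR : R ≤ ε) : g R * r ^ d ≤ g r * R ^ d := by
  obtain ⟨-, -, -, -, -, hanti⟩ := hg
  have h := hanti ⟨hr, hrR.trans hR⟩ ⟨hr.trans_le hrR, hR⟩ hrR
  have hR0 : 0 < R := hr.trans_le hrR
  simp only at h
  rwa [div_le_div_iff₀ (by positivity) (by positivity)] at h

lemma gaugeOn_pos {d : ℕ} {ε : ℝ} {g : ℝ → ℝ} (hg : IsGaugeOn d ε g) {r : ℝ} (hr : 0 < r)
    (hR : r ≤ ε) : 0 < g r := by
  obtain ⟨-, -, -, -, hp, -⟩ := hg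
  have := hp r ⟨hr, hR⟩
  rwa [div_pos_iff_of_pos_right (by positivity)] at this

/-- The net measure of a cube is the gauge of its diameter (lower bound). -/
lemma cube_le_net {d c : ℕ} (hd : 0 < d) (hc : 2 ≤ c) {ε : ℝ} {g : ℝ → ℝ} (hg : IsGaugeOn d ε g)
    {j : ℤ} {k : Fin d → ℤ} (hj : (c : ℝ) ^ (-j) < ε) {E : Set (Fin d → ℝ)}
    (hE : cadicCube d c j k ⊆ E) :
    ENNReal.ofReal (g ((c : ℝ) ^ (-j))) ≤ netMeasure d c ε g E := by
  have hc0 : (0 : ℝ) < c := by positivity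
  have hr : (0 : ℝ) < (c : ℝ) ^ (-j) := by positivity
  set R := (c : ℝ) ^ (-j) with hR
  unfold netMeasure
  refine le_iInf fun lam => le_iInf fun h1 => le_iInf fun h2 => le_iInf fun h3 => ?_
  by_cases hbig : ∃ p, R ≤ (EMetric.diam (lam p)).toReal
  · obtain ⟨p, hp⟩ := hbig
    refine le_trans (ENNReal.ofReal_le_ofReal ?_) (ENNReal.le_tsum p)
    exact hg.2.2.2.1 ⟨hr.le, hj.le⟩ ⟨hr.le.trans hp, (h2 p).le⟩ hp
  · push Not at hbig
    have hgR : 0 < g R := gaugeOn_pos hg hr hj.le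
    have hstep : ∀ p, ENNReal.ofReal (g R / R ^ d) * volume (lam p)
        ≤ ENNReal.ofReal (g (EMetric.diam (lam p)).toReal) := by
      intro p
      rcases h1 p with h | ⟨i, l, h⟩
      · rw [h]; simp
      · have hb := hbig p
        rw [h, diam_cube hd hc] at hb ⊢
        rw [volume_cube, ← ENNReal.ofReal_pow (by positivity), ← ENNReal.ofReal_mul (by positivity)]
        apply ENNReal.ofReal_le_ofReal
        have := gauge_ratio hg (r := (c : ℝ) ^ (-i)) (by positivity) hb.le hj.le
        rw [div_mul_eq_mul_div, div_le_iff₀ (by positivity)]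
        exact this
    calc ENNReal.ofReal (g R) = ENNReal.ofReal (g R / R ^ d) * volume (cadicCube d c j k) := by
          rw [volume_cube, ← ENNReal.ofReal_pow (by positivity), ← ENNReal.ofReal_mul (by positivity)]
          congr 1
          rw [← hR]; field_simp
      _ ≤ ENNReal.ofReal (g R / R ^ d) * ∑' p, volume (lam p) := by
          gcongr
          exact (measure_mono (hE.trans h3)).trans (measure_iUnion_le _)
      _ = ∑' p, ENNReal.ofReal (g R / R ^ d) * volume (lam p) := ENNReal.tsum_mul_left.symm
      _ ≤ _ := ENNReal.tsum_le_tsum hstep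

/-- Lipschitz images and net measures. -/
lemma net_image_le {d c : ℕ} (hd : 0 < d) (hc : 2 ≤ c) {ε : ℝ} {g : ℝ → ℝ} (hg : IsGaugeOn d ε g)
    {f : (Fin d → ℝ) → (Fin d → ℝ)} {K : ℝ} (M : ℕ) (hM : K ≤ M) (hK : 0 < K)
    {T : Set (Fin d → ℝ)} (hf : ∀ x ∈ T, ∀ y ∈ T, dist (f x) (f y) ≤ K * dist x y) :
    netMeasure d c ε g (f '' T)
      ≤ (Fintype.card (Fin d → Fin (2 * M + 1)) : ℝ≥0∞) * netMeasure d c ε g T := by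
  have hc0 : (0 : ℝ) < c := by positivity
  conv_rhs => unfold netMeasure
  have hcard0 : (Fintype.card (Fin d → Fin (2 * M + 1)) : ℝ≥0∞) ≠ ∞ := ENNReal.natCast_ne_top _
  simp only [ENNReal.mul_iInf_of_ne (show (Fintype.card (Fin d → Fin (2 * M + 1)) : ℝ≥0∞) ≠ 0 from
    Nat.cast_ne_zero.2 Fintype.card_ne_zero) hcard0]
  refine le_iInf fun lam => le_iInf fun h1 => le_iInf fun h2 => le_iInf fun h3 => ?_
  have hloc : ∀ p, ∃ C : (Fin d → Fin (2 * M + 1)) → Set (Fin d → ℝ),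
      (∀ e, C e = ∅ ∨ ∃ j k, C e = cadicCube d c j k) ∧
      (∀ e, (EMetric.diam (C e)).toReal = (EMetric.diam (lam p)).toReal) ∧
      f '' (lam p ∩ T) ⊆ ⋃ e, C e := by
    intro p
    rcases h1 p with h | ⟨j, k, h⟩
    · refine ⟨fun _ => ∅, fun _ => Or.inl rfl, fun _ => by rw [h], by simp [h]⟩
    · by_cases hne : (lam p ∩ T).Nonempty
      · obtain ⟨z0, hz0, hz0T⟩ := hne
        refine ⟨fun e => cadicCube d c j (fun s => ⌊f z0 s * (c : ℝ) ^ j⌋ + ((e s : ℕ) : ℤ) - M),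
          fun e => Or.inr ⟨_, _, rfl⟩, fun e => by rw [h, diam_cube hd hc, diam_cube hd hc], ?_⟩
        rintro _ ⟨z, ⟨hz, hzT⟩, rfl⟩
        have hdist : dist z z0 ≤ (c : ℝ) ^ (-j) := by
          have h5 : edist z z0 ≤ ENNReal.ofReal ((c : ℝ) ^ (-j)) := by
            rw [← ediam_cube hd hc j k, ← h]
            exact Metric.edist_le_ediam_of_mem hz hz0
          rw [edist_dist] at h5
          exact (ENNReal.ofReal_le_ofReal_iff (by positivity)).1 h5
        have hco : ∀ s, |f z s * (c : ℝ) ^ j - f z0 s * (c : ℝ) ^ j| ≤ M := by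
          intro s
          rw [← sub_mul, abs_mul, abs_of_pos (show (0 : ℝ) < (c : ℝ) ^ j by positivity)]
          have h6 : |f z s - f z0 s| ≤ K * (c : ℝ) ^ (-j) := by
            rw [← Real.dist_eq]
            exact (dist_le_pi_dist _ _ s).trans ((hf z hzT z0 hz0T).trans (by gcongr))
          calc _ ≤ K * (c : ℝ) ^ (-j) * (c : ℝ) ^ j := by gcongr
            _ = K := by rw [mul_assoc, ← zpow_add₀ hc0.ne']; simp
            _ ≤ M := hM
        have hfl : ∀ s, ⌊f z s * (c : ℝ) ^ j⌋ ≤ ⌊f z0 s * (c : ℝ) ^ j⌋ + M ∧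
            ⌊f z0 s * (c : ℝ) ^ j⌋ ≤ ⌊f z s * (c : ℝ) ^ j⌋ + M := by
          intro s
          have := abs_le.1 (hco s)
          constructor
          · rw [← Int.floor_add_natCast]; exact Int.floor_le_floor (by linarith)
          · rw [← Int.floor_add_natCast]; exact Int.floor_le_floor (by linarith)
        refine mem_iUnion.2 ⟨fun s => ⟨(⌊f z s * (c : ℝ) ^ j⌋ - ⌊f z0 s * (c : ℝ) ^ j⌋ + M).toNat, ?_⟩, ?_⟩
        · have := hfl s; omega
        · rw [mem_cube_iff hc]
          intro s
          have := hfl s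
          simp only
          omega
      · rw [not_nonempty_iff_eq_empty] at hne
        refine ⟨fun _ => lam p, fun _ => h1 p, fun _ => rfl, by simp [hne]⟩
  choose C hC1 hC2 hC3 using hloc
  refine (net_le (ι := ℕ × (Fin d → Fin (2 * M + 1))) hg.2.1 hg.1 (fun q => C q.1 q.2)
    (fun q => hC1 q.1 q.2) (fun q => by rw [hC2]; exact h2 _) ?_).trans ?_
  · rintro _ ⟨z, hz, rfl⟩
    obtain ⟨p, hp⟩ := mem_iUnion.1 (h3 hz)
    obtain ⟨e, he⟩ := mem_iUnion.1 (hC3 p ⟨z, ⟨hp, hz⟩, rfl⟩)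
    exact mem_iUnion.2 ⟨(p, e), he⟩
  · rw [ENNReal.tsum_prod', ← ENNReal.tsum_mul_left]
    refine ENNReal.tsum_le_tsum fun p => ?_
    simp only [hC2]
    rw [tsum_fintype, Finset.sum_const, nsmul_eq_mul, Finset.card_univ]

lemma tendsto_scale {c : ℕ} (hc : 2 ≤ c) :
    Tendsto (fun m : ℕ => (c : ℝ) ^ (-(m : ℤ))) atTop (nhds 0) := by
  have h1 : (1 : ℝ) < c := by exact_mod_cast hc
  have h := tendsto_inv_atTop_zero.comp (tendsto_pow_atTop_atTop_of_one_lt h1)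
  refine h.congr fun m => ?_
  simp [zpow_neg]

lemma cube_dist_le {d c : ℕ} (hd : 0 < d) (hc : 2 ≤ c) {j : ℤ} {k : Fin d → ℤ}
    {y x : Fin d → ℝ} (hy : y ∈ cadicCube d c j k) (hx : x ∈ cadicCube d c j k) :
    dist y x ≤ (c : ℝ) ^ (-j) := by
  have h5 : edist y x ≤ ENNReal.ofReal ((c : ℝ) ^ (-j)) := by
    rw [← ediam_cube hd hc j k]
    exact Metric.edist_le_ediam_of_mem hy hx
  rw [edist_dist] at h5
  exact (ENNReal.ofReal_le_ofReal_iff (by positivity)).1 h5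

/-- A uniform lower bound on cubes upgrades to full net measure. -/
lemma net_upgrade {d c : ℕ} (hd : 0 < d) (hc : 2 ≤ c) {ε : ℝ} {g : ℝ → ℝ} (hg : IsGaugeOn d ε g)
    {U E : Set (Fin d → ℝ)} (hU : IsOpen U) {N : ℝ≥0∞} (hN : N ≠ ∞)
    (hE : ∀ (j : ℤ) (k : Fin d → ℤ), cadicCube d c j k ⊆ U → (c : ℝ) ^ (-j) < ε →
      ENNReal.ofReal (g ((c : ℝ) ^ (-j))) ≤ N * netMeasure d c ε g (E ∩ cadicCube d c j k)) :
    netMeasure d c ε g U ≤ netMeasure d c ε g (E ∩ U) := by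
  classical
  have hc0 : (0 : ℝ) < c := by positivity
  have hc1 : (1 : ℝ) < c := by exact_mod_cast hc
  conv_rhs => unfold netMeasure
  refine le_iInf fun lam => le_iInf fun h1 => le_iInf fun h2 => le_iInf fun h3 => ?_
  set a : ℕ → ℝ≥0∞ := fun p => ENNReal.ofReal (g (EMetric.diam (lam p)).toReal) with ha
  have ha0 : ∀ p, lam p = ∅ → a p = 0 := by
    intro p hp
    simp only [ha, hp, diam_empty_toReal, hg.1, ENNReal.ofReal_zero]
  by_cases hS : ∑' p, a p = ∞
  · rw [hS]; exact le_top
  refine ENNReal.le_of_forall_pos_le_add fun η hη _ => ?_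
  have hη' : (0 : ℝ≥0∞) < η / N := ENNReal.div_pos (by exact_mod_cast hη.ne') hN
  obtain ⟨s, hs⟩ := ((ENNReal.tendsto_tsum_compl_atTop_zero hS).eventually_lt_const hη').exists
  have hJ : ∀ᶠ J : ℕ in atTop, (c : ℝ) ^ (-(J : ℤ)) < ε ∧ ∀ p ∈ s,
      0 < (EMetric.diam (lam p)).toReal → (c : ℝ) ^ (-(J : ℤ)) < (EMetric.diam (lam p)).toReal := by
    refine ((tendsto_scale hc).eventually_lt_const hg.2.1).and ?_
    rw [Filter.eventually_all_finset]
    intro p _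
    by_cases hp : 0 < (EMetric.diam (lam p)).toReal
    · filter_upwards [(tendsto_scale hc).eventually_lt_const hp] with J hJ _ using hJ
    · exact Filter.Eventually.of_forall fun J h => absurd h hp
  obtain ⟨J, hJε, hJs⟩ := hJ.exists
  let Q : ℕ × (Fin d → ℤ) → Set (Fin d → ℝ) := fun i => cadicCube d c ((J : ℤ) + i.1) i.2
  let D : Set (ℕ × (Fin d → ℤ)) := {i | Q i ⊆ U ∧
    (∀ i' : ℕ × (Fin d → ℤ), i'.1 < i.1 → Q i ⊆ Q i' → ¬ Q i' ⊆ U) ∧ ∀ p, ¬ Q i ⊆ lam p}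
  have hscale : ∀ m : ℕ, (c : ℝ) ^ (-((J : ℤ) + m)) ≤ (c : ℝ) ^ (-(J : ℤ)) := fun m =>
    zpow_le_zpow_right₀ hc1.le (by omega)
  have hcov : U ⊆ ⋃ x : ℕ ⊕ D, Sum.elim lam (fun i : D => Q i) x := by
    intro x hx
    have hex : ∃ m : ℕ, Q (m, fun s => ⌊x s * (c : ℝ) ^ ((J : ℤ) + m)⌋) ⊆ U := by
      obtain ⟨ρ, hρ, hball⟩ := Metric.isOpen_iff.1 hU x hx
      obtain ⟨m, hm⟩ := ((tendsto_scale hc).eventually_lt_const hρ).exists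
      refine ⟨m, fun y hy => hball ?_⟩
      refine lt_of_le_of_lt (cube_dist_le hd hc hy (self_mem_cube hc _ x)) (lt_of_le_of_lt ?_ hm)
      exact zpow_le_zpow_right₀ hc1.le (by simp)
    set m := Nat.find hex with hm
    have hmU := Nat.find_spec hex
    rw [← hm] at hmU
    have hxm : x ∈ Q (m, fun s => ⌊x s * (c : ℝ) ^ ((J : ℤ) + m)⌋) := self_mem_cube hc _ x
    by_cases hp : ∃ p, Q (m, fun s => ⌊x s * (c : ℝ) ^ ((J : ℤ) + m)⌋) ⊆ lam p
    · obtain ⟨p, hp⟩ := hp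
      exact mem_iUnion.2 ⟨Sum.inl p, hp hxm⟩
    · push Not at hp
      refine mem_iUnion.2 ⟨Sum.inr ⟨_, hmU, ?_, hp⟩, hxm⟩
      rintro ⟨m', k'⟩ hlt hsub hU'
      have hk := (mem_cube_iff hc).1 (hsub hxm)
      apply Nat.find_min hex hlt
      have : (fun s => ⌊x s * (c : ℝ) ^ ((J : ℤ) + m')⌋) = k' := funext hk
      rw [this]; exact hU'
  have hdiamQ : ∀ i, (EMetric.diam (Q i)).toReal = (c : ℝ) ^ (-((J : ℤ) + i.1)) := fun i =>
    diam_cube hd hc _ _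
  have hle := net_le (c := c) hg.2.1 hg.1 (Sum.elim lam (fun i : D => Q i))
    (by
      rintro (p | i)
      · exact h1 p
      · exact Or.inr ⟨_, _, rfl⟩)
    (by
      rintro (p | i)
      · exact h2 p
      · simp only [Sum.elim_inr, hdiamQ]; exact (hscale _).trans_lt hJε) hcov
  refine hle.trans ?_
  rw [ENNReal.summable.tsum_sum ENNReal.summable]
  simp only [Sum.elim_inl, Sum.elim_inr]
  gcongr
  have hper : ∀ i : D, ENNReal.ofReal (g (EMetric.diam (Q i)).toReal)
      ≤ N * ∑' p, (if lam p ⊆ Q i then a p else 0) := by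
    rintro ⟨i, hiU, himax, hilam⟩
    simp only [hdiamQ]
    refine (hE _ i.2 hiU ((hscale _).trans_lt hJε)).trans ?_
    gcongr
    refine (net_le (c := c) hg.2.1 hg.1 (fun p => if lam p ⊆ Q i then lam p else ∅) ?_ ?_ ?_).trans
      (le_of_eq (tsum_congr fun p => ?_))
    · intro p; split_ifs
      · exact h1 p
      · exact Or.inl rfl
    · intro p; split_ifs
      · exact h2 p
      · rw [diam_empty_toReal]; exact hg.2.1
    · rintro x ⟨hxE, hxQ⟩
      obtain ⟨p, hp⟩ := mem_iUnion.1 (h3 ⟨hxE, hiU hxQ⟩)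
      refine mem_iUnion.2 ⟨p, ?_⟩
      have hsub : lam p ⊆ Q i := by
        rcases h1 p with h | ⟨j, k, h⟩
        · rw [h]; exact empty_subset _
        · rcases le_total j ((J : ℤ) + i.1) with hj | hj
          · exact absurd (by rw [h]; exact cube_subset hc hj (h ▸ hp) hxQ) (hilam p)
          · rw [h]; exact cube_subset hc hj hxQ (h ▸ hp)
      rw [if_pos hsub]; exact hp
    · split_ifs
      · rfl
      · rw [diam_empty_toReal, hg.1, ENNReal.ofReal_zero]
  have hswap : ∀ p, ∑' i : D, (if lam p ⊆ Q i then a p else 0) ≤ indicator {x | x ∉ s} a p := by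
    intro p
    by_cases hp0 : a p = 0
    · simp [hp0]
    by_cases hi : ∃ i : D, lam p ⊆ Q i
    · obtain ⟨i0, hi0⟩ := hi
      have hne : lam p ≠ ∅ := fun h => hp0 (ha0 p h)
      obtain ⟨x, hx⟩ := nonempty_iff_ne_empty.2 hne
      have hps : p ∉ s := by
        intro hps
        rcases h1 p with h | ⟨j, k, h⟩
        · exact hne h
        have hdp : (EMetric.diam (lam p)).toReal = (c : ℝ) ^ (-j) := by rw [h, diam_cube hd hc]
        have hlt := hJs p hps (by rw [hdp]; positivity)
        have hle : (EMetric.diam (lam p)).toReal ≤ (EMetric.diam (Q i0)).toReal := by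
          apply ENNReal.toReal_mono
          · have : EMetric.diam (Q i0) = _ := ediam_cube hd hc _ _
            rw [this]; exact ENNReal.ofReal_ne_top
          · exact Metric.ediam_mono hi0
        rw [hdiamQ] at hle
        exact absurd (hle.trans (hscale _)) (not_le.2 hlt)
      rw [tsum_eq_single i0]
      · rw [if_pos hi0, indicator_of_mem (show p ∈ {x | x ∉ s} from hps)]
      · intro i hine
        rw [if_neg]
        intro hsub
        apply hine
        have key : ∀ i i' : D, x ∈ Q i → x ∈ Q i' → i.1.1 ≤ i'.1.1 → i = i' := by
          intro i i' hxi hxi' hle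
          rcases hle.lt_or_eq with hlt | heq
          · exact absurd i.2.1 (i'.2.2.1 i.1 hlt (cube_subset hc (by omega) hxi hxi'))
          · apply Subtype.ext
            refine Prod.ext heq (funext fun s => ?_)
            have e1 := (mem_cube_iff hc).1 hxi s
            have e2 := (mem_cube_iff hc).1 hxi' s
            rw [← e1, ← e2, heq]
        rcases le_total i.1.1 i0.1.1 with h | h
        · exact key _ _ (hsub hx) (hi0 hx) h
        · exact (key _ _ (hi0 hx) (hsub hx) h).symm
    · push Not at hi
      simp [hi]
  calc ∑' i : D, ENNReal.ofReal (g (EMetric.diam (Q i)).toReal)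
      ≤ ∑' i : D, N * ∑' p, (if lam p ⊆ Q i then a p else 0) := ENNReal.tsum_le_tsum hper
    _ = N * ∑' p, ∑' i : D, (if lam p ⊆ Q i then a p else 0) := by
        rw [ENNReal.tsum_mul_left, ENNReal.tsum_comm]
    _ ≤ N * ∑' p, indicator {x | x ∉ s} a p := by
        gcongr with p; exact hswap p
    _ ≤ N * (η / N) := by
        gcongr
        rw [← tsum_subtype]
        exact hs.le
    _ ≤ η := ENNReal.mul_div_le

/-- If `f : V → ℝ^d` is bi-Lipschitz and `F ∈ G^h(f(V))`, then `f⁻¹(F) ∈ G^h(V)`. -/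
theorem stmt14 (d c : ℕ) (hd : 0 < d) (hc : 2 ≤ c) (h : ℝ → ℝ) (hh : IsGauge d h)
    (V : Set (Fin d → ℝ)) (hV : IsOpen V) (hVne : V.Nonempty)
    (f : (Fin d → ℝ) → (Fin d → ℝ)) (K : ℝ) (hK : 0 < K)
    (hbil : ∀ x ∈ V, ∀ y ∈ V,
      K⁻¹ * dist x y ≤ dist (f x) (f y) ∧ dist (f x) (f y) ≤ K * dist x y)
    (F : Set (Fin d → ℝ)) (hF : LargeIntersection d c h (f '' V) F) :
    LargeIntersection d c h V (V ∩ f ⁻¹' F) := by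
  have hc0 : (0 : ℝ) < c := by positivity
  have hc1 : (1 : ℝ) < c := by exact_mod_cast hc
  have hcont : ContinuousOn f V := by
    have : LipschitzOnWith K.toNNReal f V :=
      LipschitzOnWith.of_dist_le_mul fun x hx y hy => by
        rw [Real.coe_toNNReal _ hK.le]; exact (hbil x hx y hy).2
    exact this.continuousOn
  refine ⟨?_, ?_⟩
  · obtain ⟨T, hTo, hTc, hT⟩ := hF.1
    have hEq : V ∩ f ⁻¹' F = V ∩ ⋂ t ∈ T, V ∩ f ⁻¹' t := by
      rw [hT]
      ext x
      simp only [mem_inter_iff, mem_preimage, mem_sInter, mem_iInter]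
      exact ⟨fun h => ⟨h.1, fun t ht => ⟨h.1, h.2 t ht⟩⟩, fun h => ⟨h.1, fun t ht => (h.2 t ht).2⟩⟩
    rw [hEq]
    exact hV.isGδ.inter (IsGδ.biInter hTc fun t ht =>
      (hcont.isOpen_inter_preimage hV (hTo t ht)).isGδ)
  intro g ε hg hprec U hU hUV
  apply le_antisymm (net_mono inter_subset_right)
  obtain ⟨m, hm⟩ := pow_unbounded_of_one_lt (2 * K) hc1
  refine net_upgrade hd hc hg hU
    (N := ENNReal.ofReal (((c : ℝ) ^ m) ^ d) *
      (Fintype.card (Fin d → Fin (2 * ⌈K⌉₊ + 1)) : ℝ≥0∞))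
    (ENNReal.mul_ne_top ENNReal.ofReal_ne_top (ENNReal.natCast_ne_top _)) ?_
  intro j k hq hj
  set R := (c : ℝ) ^ (-j) with hR
  have hR0 : 0 < R := by positivity
  set x : Fin d → ℝ := fun s => ((k s : ℝ) + 1 / 2) * R with hx
  have hball : Metric.ball x (R / 2) ⊆ cadicCube d c j k := by
    intro y hy s
    have h1 : |y s - x s| < R / 2 := by
      rw [← Real.dist_eq]; exact (dist_le_pi_dist _ _ s).trans_lt hy
    have h2 := abs_lt.1 h1
    simp only [hx] at h2
    rw [← hR]
    constructor <;> nlinarith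
  have hqV : cadicCube d c j k ⊆ V := hq.trans hUV
  have hsub := ball_subset_image_of_bilip (f := f) (x0 := x) hd hK (half_pos hR0)
    (fun y hy z hz => hbil y (hqV (hball hy)) z (hqV (hball hz)))
  have hRm : (c : ℝ) ^ (-(j + m)) = R / (c : ℝ) ^ m := by
    rw [neg_add, zpow_add₀ hc0.ne', ← hR, zpow_neg, zpow_natCast, div_eq_mul_inv]
  have hcm : (1 : ℝ) ≤ (c : ℝ) ^ m := one_le_pow₀ hc1.le
  have hRmle : R / (c : ℝ) ^ m ≤ R := div_le_self hR0.le hcm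
  have hQ : cadicCube d c (j + m) (fun s => ⌊f x s * (c : ℝ) ^ (j + m)⌋) ⊆
      Metric.ball (f x) (R / 2 / K) := by
    intro y hy
    refine (cube_dist_le hd hc hy (self_mem_cube hc _ _)).trans_lt ?_
    rw [hRm, div_div]
    gcongr
  have s1 := cube_le_net hd hc hg (by rw [hRm]; exact hRmle.trans_lt hj) hQ
  have s2 := hF.2 g ε hg hprec (Metric.ball (f x) (R / 2 / K)) Metric.isOpen_ball
    (hsub.trans (image_mono (hball.trans hqV)))
  have s3 : F ∩ Metric.ball (f x) (R / 2 / K) ⊆ f '' (V ∩ f ⁻¹' F ∩ cadicCube d c j k) := by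
    rintro y ⟨hyF, hyB⟩
    obtain ⟨z, hz, rfl⟩ := hsub hyB
    exact ⟨z, ⟨⟨hqV (hball hz), hyF⟩, hball hz⟩, rfl⟩
  have s4 := net_image_le (f := f) hd hc hg ⌈K⌉₊ (Nat.le_ceil K) hK
    (T := V ∩ f ⁻¹' F ∩ cadicCube d c j k) (fun y hy z hz => (hbil y hy.1.1 z hz.1.1).2)
  have s5 : g R ≤ ((c : ℝ) ^ m) ^ d * g (R / (c : ℝ) ^ m) := by
    have := gauge_ratio hg (r := R / (c : ℝ) ^ m) (by positivity) hRmle hj.le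
    rw [div_pow, mul_div_assoc', div_le_iff₀ (by positivity)] at this
    have hRd : 0 < R ^ d := by positivity
    refine le_of_mul_le_mul_right ?_ hRd
    linarith
  calc ENNReal.ofReal (g R) ≤ ENNReal.ofReal (((c : ℝ) ^ m) ^ d * g (R / (c : ℝ) ^ m)) :=
        ENNReal.ofReal_le_ofReal s5
    _ = ENNReal.ofReal (((c : ℝ) ^ m) ^ d) * ENNReal.ofReal (g (R / (c : ℝ) ^ m)) :=
        ENNReal.ofReal_mul (by positivity)
    _ ≤ ENNReal.ofReal (((c : ℝ) ^ m) ^ d) *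
        ((Fintype.card (Fin d → Fin (2 * ⌈K⌉₊ + 1)) : ℝ≥0∞) *
          netMeasure d c ε g (V ∩ f ⁻¹' F ∩ cadicCube d c j k)) := by
        gcongr
        rw [← hRm]
        exact s1.trans (s2.symm.le.trans ((net_mono s3).trans s4))
    _ = _ := (mul_assoc _ _ _).symm
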